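/- For a ribbonless graph H = (N,F) and disjoint subsets M and C of N, the independence model of H after marginalisation over M and conditioning on C equals the independence model induced by the generated graph: α(J_m(H);M,C) = J_m(α_RG(H;M,C)). -/

import Mathlib

/-!
Stable mixed graphs: mixed graphs with arrows, arcs and lines; ribbonless,
summary and ancestral graphs; the generating maps α_RG, α_SG, α_AG;
m-connecting paths, m-separation and induced independence models.
-/

namespace StableMixedGraphs

/-- A mixed graph on node type `V`: a node set together with three edge
relations: arrows (`arrow i j` means an arrow from `i` to `j`), arcs
(two-headed, symmetric) and lines (undirected, symmetric). -/
structure MixedGraph (V : Type) where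
  nodes : Set V
  arrow : V → V → Prop
  arc : V → V → Prop
  line : V → V → Prop

namespace MixedGraph

variable {V W : Type}

/-- Wellformedness: arcs and lines are symmetric relations and all edges join
nodes of the graph. -/
def Wf (G : MixedGraph V) : Prop :=
  (∀ i j, G.arc i j → G.arc j i) ∧
  (∀ i j, G.line i j → G.line j i) ∧
  (∀ i j, G.arrow i j ∨ G.arc i j ∨ G.line i j → i ∈ G.nodes ∧ j ∈ G.nodes)

/-- No loops of any of the three kinds. -/
def Loopless (G : MixedGraph V) : Prop :=
  ∀ i, ¬ G.arrow i i ∧ ¬ G.arc i i ∧ ¬ G.line i i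

/-- A loopless mixed graph with a finite node set. -/
def IsLMG (G : MixedGraph V) : Prop := G.Wf ∧ G.Loopless ∧ G.nodes.Finite

/-- `G.anc i j` : `i` is an ancestor of `j`, i.e. there is a
direction-preserving path from `i` to `j`. -/
def anc (G : MixedGraph V) (i j : V) : Prop := Relation.TransGen G.arrow i j

/-- The set of ancestors of nodes of `C`. -/
def anSet (G : MixedGraph V) (C : Set V) : Set V := {a | ∃ c ∈ C, G.anc a c}

/-- `i` lies on a direction-preserving cycle. -/
def OnDPCycle (G : MixedGraph V) (i : V) : Prop := G.anc i i

/-- `i` is an endpoint of a line. -/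
def LineEndpoint (G : MixedGraph V) (i : V) : Prop := ∃ j, G.line i j

/-- Condition (2) of a ribbon: `i` or a descendant of `i` is an endpoint of a
line or lies on a direction-preserving cycle. -/
def RibbonTail (G : MixedGraph V) (i : V) : Prop :=
  ∃ d, (d = i ∨ G.anc i d) ∧ (G.LineEndpoint d ∨ G.OnDPCycle d)

/-- `G` contains a ribbon: a collider V-configuration `⟨h,i,j⟩` with no
endpoint-identical edge between `h` and `j`, whose inner node `i` (or a
descendant of it) is an endpoint of a line or on a direction-preserving
cycle. -/
def HasRibbon (G : MixedGraph V) : Prop :=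
  ∃ h i j, h ≠ i ∧ i ≠ j ∧ h ≠ j ∧ G.RibbonTail i ∧
    ((G.arc h i ∧ G.arc i j ∧ ¬ G.arc h j) ∨
     (G.arrow h i ∧ G.arrow j i ∧ ¬ G.line h j) ∨
     (G.arrow h i ∧ G.arc i j ∧ ¬ G.arrow h j))

/-- A ribbonless graph: a loopless mixed graph with no ribbon. -/
def IsRG (G : MixedGraph V) : Prop := G.IsLMG ∧ ¬ G.HasRibbon

/-- A directed acyclic graph: only arrows, no direction-preserving cycle. -/
def IsDAG (G : MixedGraph V) : Prop :=
  G.IsLMG ∧ (∀ i j, ¬ G.arc i j) ∧ (∀ i j, ¬ G.line i j) ∧ ∀ i, ¬ G.anc i i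

/-- A summary graph: a loopless mixed graph with no arrowhead pointing to an
endpoint of a line and no direction-preserving cycle. -/
def IsSG (G : MixedGraph V) : Prop :=
  G.IsLMG ∧ (∀ i, G.LineEndpoint i → ∀ k, ¬ G.arrow k i ∧ ¬ G.arc k i) ∧
    ∀ i, ¬ G.anc i i

/-- A simple mixed graph: no loops and no multiple edges. -/
def Simple (G : MixedGraph V) : Prop :=
  G.Loopless ∧ ∀ i j,
    (G.arrow i j → ¬ G.arrow j i ∧ ¬ G.arc i j ∧ ¬ G.line i j) ∧
    (G.arc i j → ¬ G.line i j)

/-- An ancestral graph: a simple mixed graph such that no node is an ancestor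
of one of its parents or spouses, and a node with a neighbour has neither
parents nor spouses. -/
def IsAG (G : MixedGraph V) : Prop :=
  G.Wf ∧ G.Simple ∧ G.nodes.Finite ∧
  (∀ i j, G.arrow j i ∨ G.arc j i → ¬ G.anc i j) ∧
  (∀ i, G.LineEndpoint i → ∀ k, ¬ G.arrow k i ∧ ¬ G.arc k i)

/-- An undirected graph: only lines. -/
def IsUG (G : MixedGraph V) : Prop :=
  G.IsLMG ∧ (∀ i j, ¬ G.arrow i j) ∧ ∀ i j, ¬ G.arc i j

/-- A bidirected graph: only arcs. -/
def IsBG (G : MixedGraph V) : Prop :=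
  G.IsLMG ∧ (∀ i j, ¬ G.arrow i j) ∧ ∀ i j, ¬ G.line i j

/-- Image of a mixed graph under a map of node types. -/
def map (f : V → W) (G : MixedGraph V) : MixedGraph W where
  nodes := f '' G.nodes
  arrow a b := ∃ i j, G.arrow i j ∧ f i = a ∧ f j = b
  arc a b := ∃ i j, G.arc i j ∧ f i = a ∧ f j = b
  line a b := ∃ i j, G.line i j ∧ f i = a ∧ f j = b

end MixedGraph

/-! ### The closure generating new edges (Table 1 of the RG-generating
algorithm), for given marginalisation set `M` and collider set
`S = C ∪ an(C)`.  For every V-configuration whose inner node is a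
non-collider in `M` (rows 1–7) or a collider in `S` (rows 8–10) the
endpoint-identical edge between the endpoints is generated, repeatedly
until closure. -/

mutual
  /-- Generated arrows (`GenArrow H M S j i`: arrow from `j` to `i`). -/
  inductive GenArrow {V : Type} (H : MixedGraph V) (M S : Set V) : V → V → Prop
    | base {i j : V} : H.arrow i j → GenArrow H M S i j
    | row1 {i j m : V} : m ∈ M → j ≠ i →
        GenArrow H M S j m → GenArrow H M S m i → GenArrow H M S j i
    | row2 {i j m : V} : m ∈ M → j ≠ i →
        GenLine H M S j m → GenArrow H M S m i → GenArrow H M S j i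
    | row3 {i j m : V} : m ∈ M → j ≠ i →
        GenLine H M S j m → GenArc H M S m i → GenArrow H M S j i
    | row8 {i j s : V} : s ∈ S → j ≠ i →
        GenArrow H M S j s → GenArc H M S s i → GenArrow H M S j i

  /-- Generated arcs. -/
  inductive GenArc {V : Type} (H : MixedGraph V) (M S : Set V) : V → V → Prop
    | base {i j : V} : H.arc i j → GenArc H M S i j
    | symm {i j : V} : GenArc H M S i j → GenArc H M S j i
    | row4 {i j m : V} : m ∈ M → i ≠ j →
        GenArrow H M S m i → GenArrow H M S m j → GenArc H M S i j
    | row5 {i j m : V} : m ∈ M → i ≠ j →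
        GenArrow H M S m i → GenArc H M S m j → GenArc H M S i j
    | row9 {i j s : V} : s ∈ S → i ≠ j →
        GenArc H M S i s → GenArc H M S s j → GenArc H M S i j

  /-- Generated lines. -/
  inductive GenLine {V : Type} (H : MixedGraph V) (M S : Set V) : V → V → Prop
    | base {i j : V} : H.line i j → GenLine H M S i j
    | symm {i j : V} : GenLine H M S i j → GenLine H M S j i
    | row6 {i j m : V} : m ∈ M → i ≠ j →
        GenLine H M S i m → GenArrow H M S j m → GenLine H M S i j
    | row7 {i j m : V} : m ∈ M → i ≠ j →
        GenLine H M S i m → GenLine H M S m j → GenLine H M S i j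
    | row10 {i j s : V} : s ∈ S → i ≠ j →
        GenArrow H M S i s → GenArrow H M S j s → GenLine H M S i j
end

variable {V : Type}

/-- The RG-generating map `α_RG(H;M,C)`: generate all edges of the closure
and delete the nodes of `M ∪ C`. -/
def alphaRG (H : MixedGraph V) (M C : Set V) : MixedGraph V where
  nodes := H.nodes \ (M ∪ C)
  arrow i j := i ∈ H.nodes \ (M ∪ C) ∧ j ∈ H.nodes \ (M ∪ C) ∧
    GenArrow H M (C ∪ H.anSet C) i j
  arc i j := i ∈ H.nodes \ (M ∪ C) ∧ j ∈ H.nodes \ (M ∪ C) ∧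
    GenArc H M (C ∪ H.anSet C) i j
  line i j := i ∈ H.nodes \ (M ∪ C) ∧ j ∈ H.nodes \ (M ∪ C) ∧
    GenLine H M (C ∪ H.anSet C) i j

/-- The arrowhead-removal operation `α_RG.SG(K;A)`: every arrowhead pointing
at a node of `A` is removed (an arrow at such a node becomes a line, an arc
becomes an arrow, an arc with both endpoints in `A` becomes a line),
repeatedly until closure. -/
def deheadAt (K : MixedGraph V) (A : Set V) : MixedGraph V where
  nodes := K.nodes
  arrow j i := i ∉ A ∧ (K.arrow j i ∨ (K.arc j i ∧ j ∈ A))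
  arc i j := K.arc i j ∧ i ∉ A ∧ j ∉ A
  line i j := K.line i j ∨ (K.arrow j i ∧ i ∈ A) ∨ (K.arrow i j ∧ j ∈ A) ∨
    (K.arc i j ∧ i ∈ A ∧ j ∈ A)

/-- The SG-generating map `α_SG(H;M,C)`: mark the nodes of `an(C)`, apply the
RG-generating construction, then remove all arrowheads pointing at marked
nodes. -/
def alphaSG (H : MixedGraph V) (M C : Set V) : MixedGraph V :=
  deheadAt (alphaRG H M C) (H.anSet C)

/-! ### Step 2 of the AG-generating algorithm: for every V-configuration
`j → k ↔ i` or `j ↔ k ↔ i` with `k ∈ an(i)` (in the current graph) generate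
an arrow from `j` to `i`, respectively an arc between `j` and `i`, until
closure. -/

mutual
  inductive AG2Arrow {V : Type} (K : MixedGraph V) : V → V → Prop
    | base {i j : V} : K.arrow j i → AG2Arrow K j i
    | gen {i j k : V} : j ≠ i → AG2Arrow K j k → AG2Arc K k i →
        AG2Anc K k i → AG2Arrow K j i

  inductive AG2Arc {V : Type} (K : MixedGraph V) : V → V → Prop
    | base {i j : V} : K.arc i j → AG2Arc K i j
    | symm {i j : V} : AG2Arc K i j → AG2Arc K j i
    | gen {i j k : V} : j ≠ i → AG2Arc K j k → AG2Arc K k i →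
        AG2Anc K k i → AG2Arc K j i

  /-- The ancestor relation of the graph being generated in step 2. -/
  inductive AG2Anc {V : Type} (K : MixedGraph V) : V → V → Prop
    | single {i j : V} : AG2Arrow K i j → AG2Anc K i j
    | tail {i k j : V} : AG2Arrow K i k → AG2Anc K k j → AG2Anc K i j
end

/-- The graph after step 2 of the AG-generating algorithm. -/
def ag2 (K : MixedGraph V) : MixedGraph V where
  nodes := K.nodes
  arrow := AG2Arrow K
  arc := AG2Arc K
  line := K.line

/-! ### Step 3 of the AG-generating algorithm: repeatedly replace every arc
between `j` and `i` with `j ∈ an(i)` (in the current graph) by an arrow from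
`j` to `i`. -/

mutual
  inductive AG3Arrow {V : Type} (K : MixedGraph V) : V → V → Prop
    | base {i j : V} : K.arrow j i → AG3Arrow K j i
    | conv {i j : V} : K.arc j i → AG3Anc K j i → AG3Arrow K j i

  /-- The ancestor relation of the graph being generated in step 3. -/
  inductive AG3Anc {V : Type} (K : MixedGraph V) : V → V → Prop
    | single {i j : V} : AG3Arrow K i j → AG3Anc K i j
    | tail {i k j : V} : AG3Arrow K i k → AG3Anc K k j → AG3Anc K i j
end

/-- Steps 2 and 3 of the AG-generating algorithm, applied to a summary
graph: `α_SG.AG`. -/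
def alphaSGAG (K : MixedGraph V) : MixedGraph V :=
  let K2 := ag2 K
  { nodes := K.nodes
    arrow := AG3Arrow K2
    arc := fun i j => K2.arc i j ∧ ¬ AG3Anc K2 i j ∧ ¬ AG3Anc K2 j i
    line := K.line }

/-- The AG-generating map `α_AG(H;M,C)`. -/
def alphaAG (H : MixedGraph V) (M C : Set V) : MixedGraph V :=
  alphaSGAG (alphaSG H M C)

/-! ### Paths, m-connection and m-separation. -/

/-- A step of a walk: it goes from `src` to `tgt` along an edge which has an
arrowhead at `src` iff `hs = true` and an arrowhead at `tgt` iff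
`ht = true` (so `hs = ht = false` is a line, `hs = ht = true` an arc, and
exactly one head an arrow in the corresponding direction). -/
structure Step (V : Type) where
  src : V
  tgt : V
  hs : Bool
  ht : Bool

/-- The edge of a step is present in `G`. -/
def Step.valid (G : MixedGraph V) (s : Step V) : Prop :=
  match s.hs, s.ht with
  | false, false => G.line s.src s.tgt
  | false, true  => G.arrow s.src s.tgt
  | true,  false => G.arrow s.tgt s.src
  | true,  true  => G.arc s.src s.tgt

/-- `w` is a path from `i` to `j` in `G`: a nonempty chained list of valid
steps with no repeated nodes. -/
def IsPath (G : MixedGraph V) (i j : V) (w : List (Step V)) : Prop :=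
  w ≠ [] ∧ (∀ s ∈ w, s.valid G) ∧ List.Chain' (fun a b => a.tgt = b.src) w ∧
    w.head?.map Step.src = some i ∧ w.getLast?.map Step.tgt = some j ∧
    (i :: w.map Step.tgt).Nodup

/-- The path `w` is m-connecting given `M` and `C`: every inner collider node
is in `C ∪ an(C)` and every inner non-collider node is in `M`. -/
def MConnPath (G : MixedGraph V) (M C : Set V) (w : List (Step V)) : Prop :=
  List.Chain'
    (fun a b =>
      (a.ht = true ∧ b.hs = true → a.tgt ∈ C ∪ G.anSet C) ∧
      (¬ (a.ht = true ∧ b.hs = true) → a.tgt ∈ M)) w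

/-- `A ⊥_m B | C` in `G` : there is no m-connecting path between `A` and `B`
given `C` (with `M` the remaining nodes). -/
def MSep (G : MixedGraph V) (A B C : Set V) : Prop :=
  ∀ i ∈ A, ∀ j ∈ B, ∀ w : List (Step V),
    IsPath G i j w → ¬ MConnPath G (G.nodes \ (A ∪ B ∪ C)) C w

/-- The independence model induced by `G` via m-separation: the set of
triples `⟨A,B|C⟩` of pairwise disjoint subsets of the nodes with
`A ⊥_m B | C`. -/
def Jm (G : MixedGraph V) : Set (Set V × Set V × Set V) :=
  {t | t.1 ⊆ G.nodes ∧ t.2.1 ⊆ G.nodes ∧ t.2.2 ⊆ G.nodes ∧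
    Disjoint t.1 t.2.1 ∧ Disjoint t.1 t.2.2 ∧ Disjoint t.2.1 t.2.2 ∧
    MSep G t.1 t.2.1 t.2.2}

/-- The independence model after marginalisation over `M` and conditioning on
`C` : `α(J;M,C)`. -/
def alphaIM (J : Set (Set V × Set V × Set V)) (M C : Set V) :
    Set (Set V × Set V × Set V) :=
  {t | (t.1, t.2.1, t.2.2 ∪ C) ∈ J ∧ (t.1 ∪ t.2.1 ∪ t.2.2) ∩ (M ∪ C) = ∅}

/-! ### Connecting walks -/

/-- An inner node `b` with marks `q` and `r` (`true` for an arrowhead) is admissible: a collider lies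
in `Q` and a non-collider lies in `P`. -/
def Admissible (P Q : Set V) (q r : Bool) (b : V) : Prop :=
  (q = true ∧ r = true → b ∈ Q) ∧ (¬ (q = true ∧ r = true) → b ∈ P)

/-- `Connected G P Q a p q b`: some walk from `a` to `b` in `G`, with mark `p` at `a` and mark `q` at
`b`, has all its inner colliders in `Q` and all its inner non-colliders in `P`. -/
inductive Connected (G : MixedGraph V) (P Q : Set V) : V → Bool → Bool → V → Prop
  | single {a b : V} {p q : Bool} : Step.valid G ⟨a, b, p, q⟩ → Connected G P Q a p q b
  | trans {a b c : V} {p q r s : Bool} : Connected G P Q a p q b → Admissible P Q q r b →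
      Connected G P Q b r s c → Connected G P Q a p s c

/-- Consecutive steps of a connecting walk. -/
def Joins (P Q : Set V) (a b : Step V) : Prop :=
  a.tgt = b.src ∧ Admissible P Q a.ht b.hs a.tgt

/-- A walk from `i` to `j`, as a list of steps, with all inner colliders in `Q` and all inner
non-colliders in `P`. -/
structure IsConnWalk (G : MixedGraph V) (P Q : Set V) (i j : V) (w : List (Step V)) : Prop where
  valid : ∀ s ∈ w, s.valid G
  chain : w.IsChain (Joins P Q)
  head : w.head?.map Step.src = some i
  last : w.getLast?.map Step.tgt = some j

theorem Step.valid_symm {G : MixedGraph V} (hG : G.Wf) {a b : V} {p q : Bool}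
    (h : Step.valid G ⟨a, b, p, q⟩) : Step.valid G ⟨b, a, q, p⟩ := by
  cases p <;> cases q <;> simp only [Step.valid] at h ⊢
  exacts [hG.2.1 _ _ h, h, h, hG.1 _ _ h]

theorem Admissible.symm {P Q : Set V} {q r : Bool} {b : V} (h : Admissible P Q q r b) :
    Admissible P Q r q b :=
  ⟨fun h' => h.1 h'.symm, fun h' => h.2 fun h'' => h' h''.symm⟩

theorem Admissible.mono {P Q P' Q' : Set V} (hP : P ⊆ P') (hQ : Q ⊆ Q') {q r : Bool} {b : V}
    (h : Admissible P Q q r b) : Admissible P' Q' q r b :=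
  ⟨fun h' => hQ (h.1 h'), fun h' => hP (h.2 h')⟩

namespace Connected

variable {G : MixedGraph V} {P Q P' Q' : Set V} {a b : V} {p q : Bool}

theorem symm (hG : G.Wf) (h : Connected G P Q a p q b) : Connected G P Q b q p a := by
  induction h with
  | single h => exact .single (Step.valid_symm hG h)
  | trans _ h _ ih₁ ih₂ => exact .trans ih₂ h.symm ih₁

/-- Replace every edge of a connecting walk by a connecting walk in another graph. -/
theorem bind {G' : MixedGraph V} (hP : P ⊆ P') (hQ : Q ⊆ Q')
    (hG : ∀ a b p q, Step.valid G ⟨a, b, p, q⟩ → Connected G' P' Q' a p q b)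
    (h : Connected G P Q a p q b) : Connected G' P' Q' a p q b := by
  induction h with
  | single h => exact hG _ _ _ _ h
  | trans _ h _ ih₁ ih₂ => exact .trans ih₁ (h.mono hP hQ) ih₂

theorem mono (hP : P ⊆ P') (hQ : Q ⊆ Q') (h : Connected G P Q a p q b) :
    Connected G P' Q' a p q b :=
  h.bind hP hQ fun _ _ _ _ => .single

/-- Following a connecting walk that starts with a tail, one meets a line or a collider, unless the
whole walk is direction-preserving. -/
theorem mem_or_anc {T : Set V} (hQ : Q ⊆ T) (harrow : ∀ x y, G.arrow x y → y ∈ T → x ∈ T)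
    (hline : ∀ x y, G.line x y → x ∈ T) (h : Connected G P Q a p q b) (hp : p = false) :
    a ∈ T ∨ (q = true ∧ G.anc a b) := by
  have hanc : ∀ x y, G.anc x y → y ∈ T → x ∈ T := fun x y hxy => by
    induction hxy using Relation.TransGen.head_induction_on with
    | single h => exact harrow _ _ h
    | head h _ ih => exact fun hy => harrow _ _ h (ih hy)
  induction h with
  | @single a b p q h =>
    subst hp
    cases q
    · exact .inl (hline _ _ h)
    · exact .inr ⟨rfl, .single h⟩
  | @trans a b c p q r s _ h _ ih₁ ih₂ =>
    rcases ih₁ hp with ha | ⟨hq, hab⟩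
    · exact .inl ha
    cases r
    · rcases ih₂ rfl with hb | ⟨hs, hbc⟩
      · exact .inl (hanc _ _ hab hb)
      · exact .inr ⟨hs, hab.trans hbc⟩
    · exact .inl (hanc _ _ hab (hQ (h.1 ⟨hq, rfl⟩)))

theorem exists_isConnWalk (h : Connected G P Q a p q b) :
    ∃ w, IsConnWalk G P Q a b w ∧ w.head?.map Step.hs = some p ∧
      w.getLast?.map Step.ht = some q := by
  induction h with
  | single h => exact ⟨[_], ⟨by simpa using h, by simp, rfl, rfl⟩, rfl, rfl⟩
  | trans _ h _ ih₁ ih₂ =>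
    obtain ⟨w, ⟨h₁, h₂, h₃, h₄⟩, h₅, h₆⟩ := ih₁
    obtain ⟨v, ⟨k₁, k₂, k₃, k₄⟩, k₅, k₆⟩ := ih₂
    simp only [Option.map_eq_some_iff] at *
    obtain ⟨x, hx, rfl⟩ := h₃
    obtain ⟨y, hy, rfl⟩ := h₄
    obtain ⟨z, hz, hzy⟩ := k₃
    obtain ⟨t, ht, rfl⟩ := k₄
    refine ⟨w ++ v, ⟨?_, List.isChain_append.2 ⟨h₂, k₂, ?_⟩, ?_, ?_⟩, ?_, ?_⟩
    · grind
    · simp_all [Joins]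
    all_goals simp_all

end Connected

theorem connected_of_isChain {G : MixedGraph V} {P Q : Set V} (s : Step V) (w : List (Step V))
    (hv : ∀ x ∈ s :: w, x.valid G) (hc : (s :: w).IsChain (Joins P Q)) :
    Connected G P Q s.src s.hs ((s :: w).getLast (by simp)).ht ((s :: w).getLast (by simp)).tgt := by
  induction w generalizing s with
  | nil => exact .single (hv s (by simp))
  | cons t w ih =>
    rw [List.isChain_cons_cons] at hc
    have h := ih t (fun x hx => hv x (by simp [hx])) hc.2
    rw [← hc.1.1] at h
    exact .trans (.single (hv s (by simp))) hc.1.2 h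

theorem IsConnWalk.exists_connected {G : MixedGraph V} {P Q : Set V} {i j : V} {w : List (Step V)}
    (h : IsConnWalk G P Q i j w) : ∃ p q, Connected G P Q i p q j := by
  obtain ⟨hv, hc, hh, hl⟩ := h
  cases w with
  | nil => simp at hh
  | cons s w =>
    have := connected_of_isChain s w hv hc
    rw [List.getLast?_eq_some_getLast (by simp)] at hl
    simp only [List.head?_cons, Option.map_some, Option.some.injEq] at hh hl
    rw [hh, hl] at this
    exact ⟨_, _, this⟩

theorem isPath_and_mConnPath_iff {G : MixedGraph V} {P C : Set V} {i j : V} {w : List (Step V)} :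
    IsPath G i j w ∧ MConnPath G P C w ↔
      IsConnWalk G P (C ∪ G.anSet C) i j w ∧ (i :: w.map Step.tgt).Nodup := by
  have key : w.IsChain (Joins P (C ∪ G.anSet C)) ↔
      List.Chain' (fun a b => a.tgt = b.src) w ∧ MConnPath G P C w := by
    simp only [MConnPath, List.Chain', List.isChain_iff_getElem, Joins, Admissible]
    exact ⟨fun h => ⟨fun i hi => (h i hi).1, fun i hi => (h i hi).2⟩,
      fun h i hi => ⟨h.1 i hi, h.2 i hi⟩⟩
  constructor
  · rintro ⟨⟨-, hv, hc, hh, hl, hn⟩, hm⟩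
    exact ⟨⟨hv, key.2 ⟨hc, hm⟩, hh, hl⟩, hn⟩
  · rintro ⟨⟨hv, hc, hh, hl⟩, hn⟩
    exact ⟨⟨by rintro rfl; simp at hh, hv, (key.1 hc).1, hh, hl, hn⟩, (key.1 hc).2⟩

namespace IsConnWalk

variable {G : MixedGraph V} {P Q : Set V} {i j : V} {l₁ l₂ : List (Step V)} {a b c d : Step V}

theorem src_eq (h : IsConnWalk G P Q i j (a :: l₂)) : a.src = i := by
  simpa using h.head

theorem tgt_eq (h : IsConnWalk G P Q i j (l₁ ++ [a])) : a.tgt = j := by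
  simpa using h.last

theorem append_cons_cons_iff :
    IsConnWalk G P Q i j (l₁ ++ a :: b :: l₂) ↔ IsConnWalk G P Q i a.tgt (l₁ ++ [a]) ∧
      IsConnWalk G P Q a.tgt j (b :: l₂) ∧ Admissible P Q a.ht b.hs a.tgt := by
  have hhead : (l₁ ++ a :: b :: l₂).head? = (l₁ ++ [a]).head? := by cases l₁ <;> rfl
  have hlast : (l₁ ++ a :: b :: l₂).getLast? = (b :: l₂).getLast? := by
    rw [List.append_cons, List.getLast?_append_of_ne_nil _ (by simp)]
  constructor
  · rintro ⟨hv, hc, hh, hl⟩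
    rw [List.isChain_append_cons_cons] at hc
    exact ⟨⟨fun s hs => hv s (by grind), hc.1, hhead ▸ hh, by simp⟩,
      ⟨fun s hs => hv s (by grind), hc.2.2, by simp [hc.2.1.1], hlast ▸ hl⟩, hc.2.1.2⟩
  · rintro ⟨⟨hv, hc, hh, hl⟩, ⟨hv', hc', hh', hl'⟩, hadm⟩
    refine ⟨fun s hs => ?_, List.isChain_append_cons_cons.2 ⟨hc, ⟨?_, hadm⟩, hc'⟩, hhead ▸ hh,
      hlast ▸ hl'⟩
    · have : s ∈ l₁ ++ [a] ∨ s ∈ b :: l₂ := by grind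
      exact this.elim (hv s) (hv' s)
    · simpa using hh'.symm

theorem replace_last (h : IsConnWalk G P Q i j (l₁ ++ [a])) (hc : c.valid G) (hsrc : c.src = a.src)
    (hhs : c.hs = a.hs) : IsConnWalk G P Q i c.tgt (l₁ ++ [c]) := by
  rcases l₁.eq_nil_or_concat with rfl | ⟨l, s, rfl⟩
  · exact ⟨by simpa using hc, by simp, by simpa [hsrc] using h.head, by simp⟩
  · simp only [List.concat_eq_append, List.append_assoc, List.cons_append, List.nil_append,
      append_cons_cons_iff] at h ⊢
    exact ⟨h.1, ⟨by simpa using hc, by simp, by simp [hsrc, h.2.1.src_eq], by simp⟩, hhs ▸ h.2.2⟩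

theorem replace_first (h : IsConnWalk G P Q i j (b :: l₂)) (hd : d.valid G) (htgt : d.tgt = b.tgt)
    (hht : d.ht = b.ht) : IsConnWalk G P Q d.src j (d :: l₂) := by
  cases l₂ with
  | nil => exact ⟨by simpa using hd, by simp, by simp, by simpa [htgt] using h.last⟩
  | cons r l =>
    have h' := append_cons_cons_iff (l₁ := []).1 h
    exact append_cons_cons_iff (l₁ := []).2
      ⟨⟨by simpa using hd, by simp, by simp, by simp⟩, htgt ▸ h'.2.1, by rw [htgt, hht]; exact h'.2.2⟩

theorem shortcut (h : IsConnWalk G P Q i j (l₁ ++ a :: b :: l₂)) (hc : c.valid G)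
    (hsrc : c.src = a.src) (hhs : c.hs = a.hs) (htgt : c.tgt = b.tgt) (hht : c.ht = b.ht) :
    IsConnWalk G P Q i j (l₁ ++ c :: l₂) := by
  have h₁ := (append_cons_cons_iff.1 h).1.replace_last hc hsrc hhs
  cases l₂ with
  | nil =>
    rw [show l₁ ++ [a, b] = (l₁ ++ [a]) ++ [b] by simp] at h
    rwa [htgt, h.tgt_eq] at h₁
  | cons r l =>
    rw [show l₁ ++ a :: b :: r :: l = (l₁ ++ [a]) ++ b :: r :: l by simp] at h
    have h₂ := append_cons_cons_iff.1 h
    exact append_cons_cons_iff.2 ⟨h₁, htgt ▸ h₂.2.1, by rw [htgt, hht]; exact h₂.2.2⟩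

/-- Cut out the part of a walk between two visits of the same node. -/
theorem cut {m : List (Step V)} (h : IsConnWalk G P Q i j (l₁ ++ a :: (m ++ b :: l₂)))
    (hab : a.tgt = b.tgt)
    (hQ : ∀ s t, (m ++ [b]).head? = some s → l₂.head? = some t → a.ht = true → s.hs = false →
      b.ht = false → t.hs = true → a.tgt ∈ Q) :
    IsConnWalk G P Q i j (l₁ ++ a :: l₂) := by
  obtain ⟨s, l, hs⟩ : ∃ s l, m ++ b :: l₂ = s :: l := by cases m <;> simp
  have hs' : (m ++ [b]).head? = some s := by cases m <;> simp_all
  have h₁ := append_cons_cons_iff.1 (hs ▸ h)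
  cases l₂ with
  | nil =>
    rw [show l₁ ++ a :: (m ++ [b]) = (l₁ ++ a :: m) ++ [b] by simp] at h
    have := h.tgt_eq
    rw [← this, ← hab]
    exact h₁.1
  | cons t k =>
    rw [show l₁ ++ a :: (m ++ b :: t :: k) = (l₁ ++ a :: m) ++ b :: t :: k by simp] at h
    have h₂ := append_cons_cons_iff.1 h
    refine append_cons_cons_iff.2 ⟨h₁.1, hab ▸ h₂.2.1, ?_, ?_⟩
    · rintro ⟨ha, ht⟩
      by_cases hsh : s.hs = true
      · exact h₁.2.2.1 ⟨ha, hsh⟩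
      by_cases hbh : b.ht = true
      · exact hab ▸ h₂.2.2.1 ⟨hbh, ht⟩
      · exact hQ s t hs' rfl ha (by simpa using hsh) (by simpa using hbh) ht
    · intro hn
      by_cases ha : a.ht = true
      · exact hab ▸ h₂.2.2.2 fun h' => hn ⟨ha, h'.2⟩
      · exact h₁.2.2.2 fun h' => ha h'.1

theorem admissible (h : IsConnWalk G P Q i j (l₁ ++ a :: b :: l₂)) :
    Admissible P Q a.ht b.hs a.tgt :=
  (append_cons_cons_iff.1 h).2.2

theorem src_mem (h : IsConnWalk G P Q i j (l₁ ++ a :: l₂)) : a.src ∈ i :: l₁.map Step.tgt := by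
  rcases l₁.eq_nil_or_concat with rfl | ⟨l, s, rfl⟩
  · simp [h.src_eq]
  · rw [List.concat_eq_append, List.append_assoc] at h
    simp [(append_cons_cons_iff.1 h).2.1.src_eq]

theorem src_ne_tgt (h : IsConnWalk G P Q i j (l₁ ++ a :: b :: l₂))
    (hn : (i :: (l₁ ++ a :: b :: l₂).map Step.tgt).Nodup) : a.src ≠ b.tgt := by
  intro hab
  have := h.src_mem
  rw [List.map_append, ← List.cons_append, List.nodup_append] at hn
  exact hn.2.2 _ this _ (by simp) hab

theorem src_mem_and_tgt_mem {X : Set V} {w : List (Step V)} (h : IsConnWalk G P Q i j w)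
    (hP : P ⊆ X) (hQ : Q ⊆ X) (hi : i ∈ X) (hj : j ∈ X) {s : Step V} (hs : s ∈ w) :
    s.src ∈ X ∧ s.tgt ∈ X := by
  have hX : ∀ {q r b}, Admissible P Q q r b → b ∈ X := fun {q r b} h' => by
    by_cases hqr : q = true ∧ r = true
    exacts [hQ (h'.1 hqr), hP (h'.2 hqr)]
  obtain ⟨l₁, l₂, rfl⟩ := List.append_of_mem hs
  constructor
  · rcases l₁.eq_nil_or_concat with rfl | ⟨l, r, rfl⟩
    · exact h.src_eq ▸ hi
    · rw [List.concat_eq_append, List.append_assoc] at h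
      have := append_cons_cons_iff.1 h
      exact this.2.1.src_eq ▸ hX this.2.2
  · cases l₂ with
    | nil => exact h.tgt_eq ▸ hj
    | cons r l => exact hX h.admissible

theorem of_forall {G' : MixedGraph V} {P' Q' : Set V} {w : List (Step V)}
    (h : IsConnWalk G P Q i j w) (hv : ∀ s ∈ w, s.valid G')
    (hadm : ∀ a b l₁ l₂, w = l₁ ++ a :: b :: l₂ → Admissible P' Q' a.ht b.hs a.tgt) :
    IsConnWalk G' P' Q' i j w := by
  refine ⟨hv, List.isChain_iff_forall_rel_of_append_cons_cons.2 fun {a b l₁ l₂} hw => ⟨?_, ?_⟩,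
    h.head, h.last⟩
  · subst hw
    exact (append_cons_cons_iff.1 h).2.1.src_eq.symm
  · exact hadm a b l₁ l₂ hw

end IsConnWalk

theorem exists_minimal_length {α : Type} (p : List α → Prop) (μ : List α → ℕ) (h : ∃ w, p w) :
    ∃ w, p w ∧ ∀ v, p v → μ w ≤ μ v := by
  obtain ⟨w, hw, hmin⟩ := exists_minimalFor_of_wellFoundedLT p μ h
  exact ⟨w, hw, fun v hv => (le_total (μ w) (μ v)).elim id fun h => hmin hv h⟩

/-! ### Walks in ribbonless graphs -/

/-- A shortest connecting walk is a path, provided that its collider set is closed under taking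
ancestors and contains all endpoints of lines. -/
theorem nodup_of_shortest {G : MixedGraph V} {P T : Set V} {i j : V} {w : List (Step V)}
    (hij : i ≠ j) (harrow : ∀ x y, G.arrow x y → y ∈ T → x ∈ T) (hline : ∀ x y, G.line x y → x ∈ T)
    (hw : IsConnWalk G P T i j w)
    (hmin : ∀ v, IsConnWalk G P T i j v → w.length ≤ v.length) :
    (i :: w.map Step.tgt).Nodup := by
  rw [List.nodup_cons]
  constructor
  · intro hi
    obtain ⟨s, hs, rfl⟩ := List.mem_map.1 hi
    obtain ⟨l₁, l₂, rfl⟩ := List.append_of_mem hs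
    cases l₂ with
    | nil => exact hij hw.tgt_eq
    | cons r l₂ =>
      have := hmin _ (IsConnWalk.append_cons_cons_iff.1 hw).2.1
      simp at this
      omega
  · by_contra hn
    obtain ⟨u, hu⟩ := List.exists_duplicate_iff_not_nodup.2 hn
    obtain ⟨k₁, k₂, hk, hu₁, hu₂⟩ : ∃ k₁ k₂, w = k₁ ++ k₂ ∧ u ∈ k₁.map Step.tgt ∧
        u ∈ k₂.map Step.tgt := by
      have := List.duplicate_iff_sublist.1 hu
      obtain ⟨r₁, r₂, h, h₁, h₂⟩ := List.cons_sublist_iff.1 this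
      obtain ⟨k₁, k₂, rfl, rfl, rfl⟩ := List.map_eq_append_iff.1 h
      exact ⟨k₁, k₂, rfl, h₁, by simpa using h₂⟩
    obtain ⟨a, ha, rfl⟩ := List.mem_map.1 hu₁
    obtain ⟨b, hb, hab⟩ := List.mem_map.1 hu₂
    obtain ⟨l₁, m₁, rfl⟩ := List.append_of_mem ha
    obtain ⟨m₂, l₂, rfl⟩ := List.append_of_mem hb
    have hk' : w = l₁ ++ a :: ((m₁ ++ m₂) ++ b :: l₂) := by simp [hk]
    have hlen : w.length ≤ (l₁ ++ a :: l₂).length := by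
      subst hk'
      refine hmin _ (hw.cut hab.symm fun s t hs _ _ hsh hbh _ => ?_)
      obtain ⟨l, hl⟩ : ∃ l, m₁ ++ m₂ ++ [b] = s :: l := by
        generalize m₁ ++ m₂ ++ [b] = k at hs
        cases k <;> simp_all
      have hseg := hw.chain.infix (l₁ := a :: (m₁ ++ m₂ ++ [b])) ⟨l₁, l₂, by simp⟩
      rw [hl, List.isChain_cons_cons] at hseg
      have hconn := connected_of_isChain s l
        (fun x hx => hw.valid x (by rw [← hl] at hx; simp at hx ⊢; tauto)) hseg.2
      have hlast : (s :: l).getLast (by simp) = b := by simp [← hl]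
      rw [hlast, hbh, ← hseg.1.1] at hconn
      have := hconn.mem_or_anc subset_rfl harrow hline hsh
      simpa using this
    subst hk'
    simp at hlen
    omega

/-- In a ribbonless graph, colliders that are ancestors of an endpoint of a line can be bypassed. -/
theorem exists_path_of_isConnWalk {G : MixedGraph V} (hG : G.IsRG) {P Q T : Set V} {i j : V}
    (hij : i ≠ j) (harrow : ∀ x y, G.arrow x y → y ∈ T → x ∈ T) (hline : ∀ x y, G.line x y → x ∈ T)
    (hT : ∀ t ∈ T, t ∈ Q ∨ G.RibbonTail t) (h : ∃ w, IsConnWalk G P T i j w) :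
    ∃ w, IsConnWalk G P Q i j w ∧ (i :: w.map Step.tgt).Nodup := by
  obtain ⟨w, hw, hmin⟩ := exists_minimal_length _ List.length h
  have hn := nodup_of_shortest hij harrow hline hw hmin
  refine ⟨w, hw.of_forall hw.valid fun a b l₁ l₂ hw' => ⟨fun hab => ?_, ?_⟩, hn⟩
  · subst hw'
    obtain ⟨ha, hb⟩ := hab
    refine (hT _ (hw.admissible.1 ⟨ha, hb⟩)).resolve_right fun htail => ?_
    have hab := (IsConnWalk.append_cons_cons_iff.1 hw).2.1.src_eq
    have hva : Step.valid G ⟨a.src, a.tgt, a.hs, true⟩ := ha ▸ hw.valid a (by simp)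
    have hvb : Step.valid G ⟨a.tgt, b.tgt, true, b.ht⟩ := hb ▸ hab ▸ hw.valid b (by simp)
    have hne := hw.src_ne_tgt hn
    have hnl : ∀ x y p q, Step.valid G ⟨x, y, p, q⟩ → x ≠ y := by
      rintro x _ p q hv rfl
      have := hG.1.2.1 x
      cases p <;> cases q <;> simp_all [Step.valid]
    have h₁ := hnl _ _ _ _ hva
    have h₂ := hnl _ _ _ _ hvb
    have hc : Step.valid G ⟨a.src, b.tgt, a.hs, b.ht⟩ := by
      by_contra hc
      apply hG.2
      generalize a.hs = p at *
      generalize b.ht = q at *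
      cases p <;> cases q <;> simp only [Step.valid] at hva hvb hc
      · exact ⟨_, _, _, h₁, h₂, hne, htail, .inr (.inl ⟨hva, hvb, hc⟩)⟩
      · exact ⟨_, _, _, h₁, h₂, hne, htail, .inr (.inr ⟨hva, hvb, hc⟩)⟩
      · exact ⟨_, _, _, h₂.symm, h₁.symm, hne.symm, htail,
          .inr (.inr ⟨hvb, hG.1.1.1 _ _ hva, hc⟩)⟩
      · exact ⟨_, _, _, h₁, h₂, hne, htail, .inl ⟨hva, hvb, hc⟩⟩
    have := hmin _ (hw.shortcut hc rfl rfl rfl rfl)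
    simp at this
  · subst hw'
    exact hw.admissible.2

/-! ### The graph of generated edges -/

/-- The closure of `H` under the generation of edges, before the deletion of nodes. -/
def generated (H : MixedGraph V) (M S : Set V) : MixedGraph V where
  nodes := H.nodes
  arrow := GenArrow H M S
  arc := GenArc H M S
  line := GenLine H M S

variable {H : MixedGraph V} {M S : Set V}

theorem Admissible.collider {P Q : Set V} {b : V} (h : b ∈ Q) : Admissible P Q true true b :=
  ⟨fun _ => h, fun h' => absurd ⟨rfl, rfl⟩ h'⟩

theorem Admissible.tail_left {P Q : Set V} {r : Bool} {b : V} (h : b ∈ P) :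
    Admissible P Q false r b :=
  ⟨fun h' => by simp at h', fun _ => h⟩

theorem Admissible.tail_right {P Q : Set V} {q : Bool} {b : V} (h : b ∈ P) :
    Admissible P Q q false b :=
  ⟨fun h' => by simp at h', fun _ => h⟩

mutual
  theorem GenArrow.connected (hH : H.Wf) {i j : V} :
      GenArrow H M S i j → Connected H M S i false true j
    | .base h => .single h
    | .row1 hm _ h₁ h₂ => (h₁.connected hH).trans (.tail_right hm) (h₂.connected hH)
    | .row2 hm _ h₁ h₂ => (h₁.connected hH).trans (.tail_right hm) (h₂.connected hH)
    | .row3 hm _ h₁ h₂ => (h₁.connected hH).trans (.tail_left hm) (h₂.connected hH)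
    | .row8 hs _ h₁ h₂ => (h₁.connected hH).trans (.collider hs) (h₂.connected hH)

  theorem GenArc.connected (hH : H.Wf) {i j : V} :
      GenArc H M S i j → Connected H M S i true true j
    | .base h => .single h
    | .symm h => (h.connected hH).symm hH
    | .row4 hm _ h₁ h₂ => ((h₁.connected hH).symm hH).trans (.tail_left hm) (h₂.connected hH)
    | .row5 hm _ h₁ h₂ => ((h₁.connected hH).symm hH).trans (.tail_left hm) (h₂.connected hH)
    | .row9 hs _ h₁ h₂ => (h₁.connected hH).trans (.collider hs) (h₂.connected hH)

  theorem GenLine.connected (hH : H.Wf) {i j : V} :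
      GenLine H M S i j → Connected H M S i false false j
    | .base h => .single h
    | .symm h => (h.connected hH).symm hH
    | .row6 hm _ h₁ h₂ => (h₁.connected hH).trans (.tail_left hm) ((h₂.connected hH).symm hH)
    | .row7 hm _ h₁ h₂ => (h₁.connected hH).trans (.tail_left hm) (h₂.connected hH)
    | .row10 hs _ h₁ h₂ => (h₁.connected hH).trans (.collider hs) ((h₂.connected hH).symm hH)
end

theorem connected_of_valid_generated (hH : H.Wf) {a b : V} {p q : Bool}
    (h : Step.valid (generated H M S) ⟨a, b, p, q⟩) : Connected H M S a p q b := by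
  cases p <;> cases q
  · exact GenLine.connected hH h
  · exact GenArrow.connected hH h
  · exact (GenArrow.connected hH h).symm hH
  · exact GenArc.connected hH h

theorem Step.valid_generated_trans {a b c : V} {p q r s : Bool}
    (h₁ : Step.valid (generated H M S) ⟨a, b, p, q⟩)
    (h₂ : Step.valid (generated H M S) ⟨b, c, r, s⟩) (hb : Admissible M S q r b) (hac : a ≠ c) :
    Step.valid (generated H M S) ⟨a, c, p, s⟩ := by
  have hca := hac.symm
  obtain ⟨hS, hM⟩ := hb
  cases p <;> cases q <;> cases r <;> cases s <;>
    simp only [and_self, and_true, not_true_eq_false, not_false_eq_true, forall_const,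
      Bool.false_eq_true, and_false, false_implies] at hS hM <;>
    simp only [Step.valid, generated] at h₁ h₂ ⊢
  · exact .row7 hM hac h₁ h₂
  · exact .row2 hM hac h₁ h₂
  · exact .row6 hM hac h₁ h₂
  · exact .row3 hM hac h₁ h₂
  · exact .symm (.row6 hM hca h₂.symm h₁)
  · exact .row1 hM hac h₁ h₂
  · exact .row10 hS hac h₁ h₂
  · exact .row8 hS hac h₁ h₂
  · exact .row2 hM hca h₂.symm h₁
  · exact .row4 hM hac h₁ h₂
  · exact .row1 hM hca h₂ h₁
  · exact .row5 hM hac h₁ h₂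
  · exact .row3 hM hca h₂.symm h₁.symm
  · exact .symm (.row5 hM hca h₂ h₁.symm)
  · exact .row8 hS hca h₂ h₁.symm
  · exact .row9 hS hac h₁ h₂

open scoped Classical in
/-- The length of a walk, counting nodes of `M` twice. -/
noncomputable def weight (M : Set V) (w : List (Step V)) : ℕ :=
  (w.map fun s => if s.tgt ∈ M then 2 else 1).sum

/-- In the graph of generated edges, connecting paths can avoid `M`, and have no colliders
in `S`. -/
theorem exists_path_avoiding {P Q : Set V} {i j : V}
    (hQM : ∀ t ∈ Q, t ∈ M → ∃ u ∈ Q, u ∉ M ∧ GenArrow H M S t u)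
    (h : ∃ w, IsConnWalk (generated H M S) P Q i j w ∧ (i :: w.map Step.tgt).Nodup) :
    ∃ w, IsConnWalk (generated H M S) (P \ M) (Q \ (S ∪ M)) i j w ∧
      (i :: w.map Step.tgt).Nodup := by
  obtain ⟨w, ⟨hw, hn⟩, hmin⟩ := exists_minimal_length _ (weight M) h
  refine ⟨w, hw.of_forall hw.valid fun a b l₁ l₂ hw' => ?_, hn⟩
  subst hw'
  obtain ⟨ha, hb, hadm⟩ := IsConnWalk.append_cons_cons_iff.1 hw
  have hva : Step.valid (generated H M S) ⟨a.src, a.tgt, a.hs, a.ht⟩ := hw.valid a (by simp)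
  have hvb : Step.valid (generated H M S) ⟨a.tgt, b.tgt, b.hs, b.ht⟩ :=
    hb.src_eq ▸ hw.valid b (by simp)
  have hnot : ¬ Admissible M S a.ht b.hs a.tgt := fun h' => by
    have := hmin _ ⟨hw.shortcut (Step.valid_generated_trans hva hvb h' (hw.src_ne_tgt hn))
      rfl rfl rfl rfl, hn.sublist (by simp)⟩
    simp only [weight, List.map_append, List.map_cons, List.sum_append, List.sum_cons] at this
    split_ifs at this <;> omega
  refine ⟨fun hab => ⟨hadm.1 hab, ?_⟩, fun hab => ⟨hadm.2 hab, fun hM => hnot ⟨fun h => absurd h hab,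
    fun _ => hM⟩⟩⟩
  rintro (hS | hM)
  · exact hnot ⟨fun _ => hS, fun h => absurd hab h⟩
  obtain ⟨u, huQ, huM, hu⟩ := hQM _ (hadm.1 hab) hM
  have hu₁ : Step.valid (generated H M S) ⟨a.tgt, u, false, true⟩ := hu
  have hu₂ : Step.valid (generated H M S) ⟨u, a.tgt, true, false⟩ := hu
  have ha' : a.src ≠ u → IsConnWalk (generated H M S) P Q i u (l₁ ++ [⟨a.src, u, a.hs, true⟩]) :=
    fun hne => ha.replace_last (c := ⟨a.src, u, a.hs, true⟩)
      (Step.valid_generated_trans hva hu₁ (.tail_right hM) hne) rfl rfl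
  have hb' : u ≠ b.tgt → IsConnWalk (generated H M S) P Q u j (⟨u, b.tgt, true, b.ht⟩ :: l₂) :=
    fun hne => hb.replace_first (d := ⟨u, b.tgt, true, b.ht⟩)
      (Step.valid_generated_trans hu₂ hvb (.tail_left hM) hne) rfl rfl
  have hsrc := hw.src_mem
  suffices ∃ v, IsConnWalk (generated H M S) P Q i j v ∧ (i :: v.map Step.tgt).Nodup ∧
      weight M v < weight M (l₁ ++ a :: b :: l₂) by
    obtain ⟨v, hv, hv', hlt⟩ := this
    exact absurd (hmin v ⟨hv, hv'⟩) (not_le.2 hlt)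
  by_cases hui : u = i
  · subst hui
    refine ⟨_, hb' (by rintro rfl; simp at hn), ?_, ?_⟩
    · simp only [List.map_append, List.map_cons, List.nodup_cons, List.nodup_append] at hn ⊢
      grind
    · simp only [weight, List.map_append, List.map_cons, List.sum_append, List.sum_cons, if_pos hM]
      omega
  by_cases hul : u ∈ l₁.map Step.tgt
  · obtain ⟨s, hs, rfl⟩ := List.mem_map.1 hul
    obtain ⟨k₁, k₂, rfl⟩ := List.append_of_mem hs
    obtain ⟨r, l, hr⟩ : ∃ r l, k₂ ++ a :: b :: l₂ = r :: l := by cases k₂ <;> simp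
    have hw' := hw
    rw [List.append_assoc, List.cons_append, hr] at hw'
    have hsplit := IsConnWalk.append_cons_cons_iff.1 hw'
    refine ⟨_, IsConnWalk.append_cons_cons_iff.2 ⟨hsplit.1, hb' ?_, ?_⟩, ?_, ?_⟩
    · intro h
      simp [List.nodup_append, h] at hn
    · refine ⟨fun _ => huQ, fun h => hsplit.2.2.2 fun h' => h ⟨h'.1, rfl⟩⟩
    · exact hn.sublist (by simp)
    · simp only [weight, List.map_append, List.map_cons, List.sum_append, List.sum_cons, if_pos hM]
      omega
  have hau : a.src ≠ u := by
    rintro rfl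
    exact (List.mem_cons.1 hsrc).elim hui hul
  by_cases hur : u ∈ (b :: l₂).map Step.tgt
  · obtain ⟨s, hs, rfl⟩ := List.mem_map.1 hur
    obtain ⟨k₁, k₂, hk⟩ := List.append_of_mem hs
    refine ⟨l₁ ++ ⟨a.src, s.tgt, a.hs, true⟩ :: k₂, ?_, ?_, ?_⟩
    · have hw' := hw
      rw [hk, ← List.cons_append, ← List.append_assoc] at hw'
      cases k₂ with
      | nil => exact hw'.tgt_eq ▸ ha' hau
      | cons r k =>
        have hsplit := IsConnWalk.append_cons_cons_iff.1 hw'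
        exact IsConnWalk.append_cons_cons_iff.2 ⟨ha' hau, hsplit.2.1,
          fun _ => huQ, fun h => hsplit.2.2.2 fun h' => h ⟨rfl, h'.2⟩⟩
    · rw [hk] at hn
      exact hn.sublist (by simp)
    · simp only [hk, weight, List.map_append, List.map_cons, List.sum_append, List.sum_cons,
        if_pos hM, if_neg huM]
      omega
  · have hub : u ≠ b.tgt := fun h => hur (by simp [h])
    refine ⟨l₁ ++ ⟨a.src, u, a.hs, true⟩ :: ⟨u, b.tgt, true, b.ht⟩ :: l₂,
      IsConnWalk.append_cons_cons_iff.2 ⟨ha' hau, hb' hub, Admissible.collider huQ⟩, ?_, ?_⟩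
    · simp only [List.map_append, List.map_cons, List.nodup_cons, List.nodup_append] at hn hur ⊢
      grind
    · simp only [weight, List.map_append, List.map_cons, List.sum_append, List.sum_cons,
        if_pos hM, if_neg huM]
      omega

/-! ### Separation in the generated graph -/

theorem mem_union_anSet_iff {G : MixedGraph V} {C : Set V} {t : V} :
    t ∈ C ∪ G.anSet C ↔ ∃ c ∈ C, Relation.ReflTransGen G.arrow t c := by
  simp only [Relation.reflTransGen_iff_eq_or_transGen, MixedGraph.anSet, MixedGraph.anc,
    Set.mem_union, Set.mem_ofPred_eq]
  constructor
  · rintro (h | ⟨c, hc, h⟩)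
    exacts [⟨t, h, .inl rfl⟩, ⟨c, hc, .inr h⟩]
  · rintro ⟨c, hc, rfl | h⟩
    exacts [.inl hc, .inr ⟨c, hc, h⟩]

theorem union_anSet_subset_nodes {G : MixedGraph V} (hG : G.Wf) {C : Set V} (hC : C ⊆ G.nodes) :
    C ∪ G.anSet C ⊆ G.nodes := by
  rintro t (ht | ⟨c, -, h⟩)
  · exact hC ht
  · obtain ⟨x, hx, -⟩ := Relation.TransGen.head'_iff.1 h
    exact (hG.2.2 _ _ (.inl hx)).1

theorem exists_genArrow_of_reflTransGen {t c : V} (h : Relation.ReflTransGen H.arrow t c)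
    (ht : t ∈ M) (hc : c ∉ M) :
    ∃ u, Relation.ReflTransGen H.arrow u c ∧ u ∉ M ∧ GenArrow H M S t u := by
  induction h using Relation.ReflTransGen.head_induction_on with
  | refl => exact absurd ht hc
  | @head t v htv hvc ih =>
    by_cases hv : v ∈ M
    · obtain ⟨u, hu, huM, hvu⟩ := ih hv
      exact ⟨u, hu, huM, .row1 hv (by rintro rfl; exact huM ht) (.base htv) hvu⟩
    · exact ⟨v, hvc, hv, .base htv⟩

theorem alphaRG_reflTransGen_of_reflTransGen (hH : H.Wf) {C : Set V} {t c : V}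
    (h : Relation.ReflTransGen H.arrow t c) (hc : c ∈ H.nodes \ (M ∪ C)) :
    t ∉ C ∪ H.anSet C → (t ∉ M → Relation.ReflTransGen (alphaRG H M C).arrow t c) ∧
      (t ∈ M → ∀ x ∈ H.nodes \ (M ∪ C), GenArrow H M (C ∪ H.anSet C) x t →
        Relation.ReflTransGen (alphaRG H M C).arrow x c) := by
  induction h using Relation.ReflTransGen.head_induction_on with
  | refl => exact fun _ => ⟨fun _ => .refl, fun h => absurd (.inl h) hc.2⟩
  | @head t v htv hvc ih =>
    intro ht
    have hv : v ∉ C ∪ H.anSet C := fun hv => ht <| by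
      obtain ⟨d, hd, hvd⟩ := mem_union_anSet_iff.1 hv
      exact mem_union_anSet_iff.2 ⟨d, hd, hvd.head htv⟩
    have hnodes := hH.2.2 _ _ (.inl htv)
    have hgood : v ∉ M → v ∈ H.nodes \ (M ∪ C) :=
      fun hvM => ⟨hnodes.2, fun h => h.elim hvM fun h => hv (.inl h)⟩
    constructor
    · intro htM
      have htgood : t ∈ H.nodes \ (M ∪ C) :=
        ⟨hnodes.1, fun h => h.elim htM fun h => ht (.inl h)⟩
      by_cases hvM : v ∈ M
      · exact (ih hv).2 hvM t htgood (.base htv)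
      · exact ((ih hv).1 hvM).head ⟨htgood, hgood hvM, .base htv⟩
    · intro htM x hx hxt
      by_cases hvM : v ∈ M
      · exact (ih hv).2 hvM x hx
          (.row1 htM (by rintro rfl; exact hx.2 (.inl hvM)) hxt (.base htv))
      by_cases hxv : x = v
      · exact hxv ▸ (ih hv).1 hvM
      · exact ((ih hv).1 hvM).head ⟨hx, hgood hvM, .row1 htM hxv hxt (.base htv)⟩

theorem Step.valid_alphaRG_iff {C : Set V} {s : Step V} :
    s.valid (alphaRG H M C) ↔ s.valid (generated H M (C ∪ H.anSet C)) ∧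
      s.src ∈ H.nodes \ (M ∪ C) ∧ s.tgt ∈ H.nodes \ (M ∪ C) := by
  obtain ⟨a, b, p, q⟩ := s
  cases p <;> cases q <;> simp only [Step.valid, alphaRG, generated] <;> tauto

theorem exists_path_alphaRG_of_exists_path (hH : H.Wf) {A B C D : Set V} (hC : C ⊆ H.nodes)
    (hMC : Disjoint M C) (hA : A ⊆ H.nodes \ (M ∪ C))
    (hB : B ⊆ H.nodes \ (M ∪ C)) (hD : D ⊆ H.nodes \ (M ∪ C)) {i j : V} (hi : i ∈ A) (hj : j ∈ B)
    (h : ∃ w, IsPath H i j w ∧ MConnPath H (H.nodes \ (A ∪ B ∪ (D ∪ C))) (D ∪ C) w) :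
    ∃ w, IsPath (alphaRG H M C) i j w ∧
      MConnPath (alphaRG H M C) ((alphaRG H M C).nodes \ (A ∪ B ∪ D)) D w := by
  simp only [isPath_and_mConnPath_iff] at h ⊢
  obtain ⟨w, hw, hn⟩ := h
  have hbase : ∀ s : Step V, s.valid H → s.valid (generated H M (C ∪ H.anSet C)) := by
    rintro ⟨a, b, p, q⟩ h
    cases p <;> cases q
    exacts [GenLine.base h, GenArrow.base h, GenArrow.base h, GenArc.base h]
  obtain ⟨v, hv, hvn⟩ := exists_path_avoiding (H := H) (M := M) (S := C ∪ H.anSet C)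
    (P := H.nodes \ (A ∪ B ∪ (D ∪ C))) (Q := (D ∪ C) ∪ H.anSet (D ∪ C)) (i := i) (j := j)
    (fun t ht htM => by
      obtain ⟨c, hc, htc⟩ := mem_union_anSet_iff.1 ht
      have hcM : c ∉ M := hc.elim (fun h h' => (hD h).2 (.inl h'))
        (fun h h' => Set.disjoint_left.1 hMC h' h)
      obtain ⟨u, huc, hu, htu⟩ := exists_genArrow_of_reflTransGen htc htM hcM
      exact ⟨u, mem_union_anSet_iff.2 ⟨c, hc, huc⟩, hu, htu⟩)
    ⟨w, hw.of_forall (fun s hs => hbase s (hw.valid s hs))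
      (by rintro a b l₁ l₂ rfl; exact hw.admissible), hn⟩
  have hP : (H.nodes \ (A ∪ B ∪ (D ∪ C))) \ M ⊆ H.nodes \ (M ∪ C) := by
    intro x hx
    simp only [Set.mem_sdiff, Set.mem_union] at hx ⊢
    tauto
  have hQ : ((D ∪ C) ∪ H.anSet (D ∪ C)) \ (C ∪ H.anSet C ∪ M) ⊆ H.nodes \ (M ∪ C) := by
    rintro x ⟨hx, hx'⟩
    refine ⟨union_anSet_subset_nodes hH (Set.union_subset (hD.trans Set.sdiff_subset) hC) hx, ?_⟩
    simp only [Set.mem_union] at hx' ⊢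
    tauto
  refine ⟨v, hv.of_forall (fun s hs => Step.valid_alphaRG_iff.2 ⟨hv.valid s hs,
    hv.src_mem_and_tgt_mem hP hQ (hA hi) (hB hj) hs⟩) ?_, hvn⟩
  rintro a b l₁ l₂ rfl
  refine Admissible.mono (P := (H.nodes \ (A ∪ B ∪ (D ∪ C))) \ M)
    (P' := (alphaRG H M C).nodes \ (A ∪ B ∪ D))
    (fun x hx => ⟨hP hx, fun h => hx.1.2 ?_⟩) ?_ hv.admissible
  · simp only [Set.mem_union] at h ⊢
    tauto
  · rintro x ⟨hx, hx'⟩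
    obtain ⟨c, hc, hxc⟩ := mem_union_anSet_iff.1 hx
    have hcD : c ∈ D :=
      hc.resolve_right fun hc => hx' (.inl (mem_union_anSet_iff.2 ⟨c, hc, hxc⟩))
    exact mem_union_anSet_iff.2 ⟨c, hcD, (alphaRG_reflTransGen_of_reflTransGen hH hxc (hD hcD)
      fun h => hx' (.inl h)).1 fun h => hx' (.inr h)⟩

theorem exists_path_of_exists_path_alphaRG (hH : H.IsRG) {A B C D : Set V} (hM : M ⊆ H.nodes)
    (hMC : Disjoint M C) (hA : A ⊆ H.nodes \ (M ∪ C)) (hB : B ⊆ H.nodes \ (M ∪ C))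
    (hD : D ⊆ H.nodes \ (M ∪ C)) {i j : V} (hij : i ≠ j)
    (h : ∃ w, IsPath (alphaRG H M C) i j w ∧
      MConnPath (alphaRG H M C) ((alphaRG H M C).nodes \ (A ∪ B ∪ D)) D w) :
    ∃ w, IsPath H i j w ∧ MConnPath H (H.nodes \ (A ∪ B ∪ (D ∪ C))) (D ∪ C) w := by
  simp only [isPath_and_mConnPath_iff] at h ⊢
  obtain ⟨w, hw, -⟩ := h
  obtain ⟨p, q, hconn⟩ := hw.exists_connected
  let T : Set V := {t | ∃ d, Relation.ReflTransGen H.arrow t d ∧ (d ∈ D ∪ C ∨ H.LineEndpoint d)}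
  have harrow : ∀ x y, H.arrow x y → y ∈ T → x ∈ T :=
    fun x y hxy ⟨d, hyd, hd⟩ => ⟨d, hyd.head hxy, hd⟩
  have hline : ∀ x y, H.line x y → x ∈ T := fun x y hxy => ⟨x, .refl, .inr ⟨y, hxy⟩⟩
  have hanT : ∀ E ⊆ D ∪ C, E ∪ H.anSet E ⊆ T := fun E hE x hx => by
    obtain ⟨c, hc, hxc⟩ := mem_union_anSet_iff.1 hx
    exact ⟨c, hxc, .inl (hE hc)⟩
  have hanc : ∀ x y, Relation.ReflTransGen H.arrow x y → y ∈ T → x ∈ T :=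
    fun x y hxy ⟨d, hyd, hd⟩ => ⟨d, hxy.trans hyd, hd⟩
  have hS : C ∪ H.anSet C ⊆ T := hanT C Set.subset_union_right
  have hvalid : ∀ a b p q, Step.valid (alphaRG H M C) ⟨a, b, p, q⟩ →
      Connected H M (C ∪ H.anSet C) a p q b :=
    fun _ _ _ _ h => connected_of_valid_generated hH.1.1 (Step.valid_alphaRG_iff.1 h).1
  have hQ : D ∪ (alphaRG H M C).anSet D ⊆ T := by
    intro t ht
    obtain ⟨c, hc, htc⟩ := mem_union_anSet_iff.1 ht
    induction htc using Relation.ReflTransGen.head_induction_on with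
    | refl => exact ⟨c, .refl, .inl (.inl hc)⟩
    | @head x y hxy hyc ih =>
      rcases (hvalid x y false true hxy).mem_or_anc hS harrow hline rfl with h | ⟨-, h⟩
      · exact h
      · exact hanc _ _ h.to_reflTransGen (ih (mem_union_anSet_iff.2 ⟨c, hc, hyc⟩))
  have hMP : M ⊆ H.nodes \ (A ∪ B ∪ (D ∪ C)) := fun x hx => ⟨hM hx, by
    rintro ((h | h) | h | h)
    exacts [(hA h).2 (.inl hx), (hB h).2 (.inl hx), (hD h).2 (.inl hx),
      Set.disjoint_left.1 hMC hx h]⟩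
  have hP : (alphaRG H M C).nodes \ (A ∪ B ∪ D) ⊆ H.nodes \ (A ∪ B ∪ (D ∪ C)) := by
    intro x hx
    simp only [alphaRG, Set.mem_sdiff, Set.mem_union] at hx ⊢
    tauto
  obtain ⟨v, hv, -⟩ := (hconn.bind hP hQ fun a b p q h => (hvalid a b p q h).mono hMP hS)
    |>.exists_isConnWalk
  refine exists_path_of_isConnWalk hH hij harrow hline ?_ ⟨v, hv⟩
  rintro t ⟨d, htd, hd | hd⟩
  · exact .inl (mem_union_anSet_iff.2 ⟨d, hd, htd⟩)
  · exact .inr ⟨d, Relation.reflTransGen_iff_eq_or_transGen.1 htd, .inl hd⟩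

theorem mSep_alphaRG_iff (hH : H.IsRG) {A B C D : Set V} (hM : M ⊆ H.nodes) (hC : C ⊆ H.nodes)
    (hMC : Disjoint M C) (hA : A ⊆ H.nodes \ (M ∪ C)) (hB : B ⊆ H.nodes \ (M ∪ C))
    (hD : D ⊆ H.nodes \ (M ∪ C)) (hAB : Disjoint A B) :
    MSep (alphaRG H M C) A B D ↔ MSep H A B (D ∪ C) := by
  constructor
  · intro h i hi j hj w hw hm
    obtain ⟨v, hv, hvm⟩ :=
      exists_path_alphaRG_of_exists_path hH.1.1 hC hMC hA hB hD hi hj ⟨w, hw, hm⟩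
    exact h i hi j hj v hv hvm
  · intro h i hi j hj w hw hm
    obtain ⟨v, hv, hvm⟩ := exists_path_of_exists_path_alphaRG hH hM hMC hA hB hD
      (fun hij => Set.disjoint_left.1 hAB hi (by rw [hij]; exact hj)) ⟨w, hw, hm⟩
    exact h i hi j hj v hv hvm

/-- (Corollary 1) For a ribbonless graph `H` and disjoint
subsets `M` and `C` of its node set, the independence model after
marginalisation over `M` and conditioning on `C` equals the independence
model induced by the generated graph:
`α(J_m(H);M,C) = J_m(α_RG(H;M,C))`. -/
theorem stmt_5 {V : Type} (H : MixedGraph V) (M C : Set V)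
    (hH : H.IsRG) (hM : M ⊆ H.nodes) (hC : C ⊆ H.nodes) (hMC : Disjoint M C) :
    alphaIM (Jm H) M C = Jm (alphaRG H M C) := by
  ext ⟨A, B, D⟩
  simp only [alphaIM, Jm, Set.mem_ofPred_eq]
  constructor
  · rintro ⟨⟨hA, hB, hDC, hAB, hAD, hBD, hsep⟩, hdisj⟩
    have hsub : ∀ E ⊆ A ∪ B ∪ D, E ⊆ H.nodes → E ⊆ H.nodes \ (M ∪ C) := fun E hE hEH x hx =>
      ⟨hEH hx, fun h => (Set.disjoint_iff_inter_eq_empty.2 hdisj).le_bot ⟨hE hx, h⟩⟩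
    have hA' := hsub A (fun _ h => .inl (.inl h)) hA
    have hB' := hsub B (fun _ h => .inl (.inr h)) hB
    have hD' := hsub D (fun _ h => .inr h) (Set.subset_union_left.trans hDC)
    exact ⟨hA', hB', hD', hAB, hAD.mono_right Set.subset_union_left,
      hBD.mono_right Set.subset_union_left, (mSep_alphaRG_iff hH hM hC hMC hA' hB' hD' hAB).2 hsep⟩
  · rintro ⟨hA, hB, hD, hAB, hAD, hBD, hsep⟩
    have hEC : ∀ E ⊆ H.nodes \ (M ∪ C), Disjoint E C := fun E hE =>
      Set.disjoint_left.2 fun x hx h => (hE hx).2 (.inr h)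
    refine ⟨⟨hA.trans Set.sdiff_subset, hB.trans Set.sdiff_subset,
      Set.union_subset (hD.trans Set.sdiff_subset) hC, hAB, Set.disjoint_union_right.2 ⟨hAD, hEC A hA⟩,
      Set.disjoint_union_right.2 ⟨hBD, hEC B hB⟩,
      (mSep_alphaRG_iff hH hM hC hMC hA hB hD hAB).1 hsep⟩, ?_⟩
    rw [← Set.disjoint_iff_inter_eq_empty, Set.disjoint_left]
    exact fun x hx => (Set.union_subset (Set.union_subset hA hB) hD hx).2

end StableMixedGraphs
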